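/- For all n ≥ 2: every tree-like Res(⊕) refutation of Ordering_n has size at least 2^{n−2}, and Space(Ordering_n) ≥ n − 2. -/

import Mathlib

open Finset

/-- The two-element field. -/
abbrev F2 : Type := ZMod 2

/-- An `F2`-linear form in the variables `V`, given by its coefficients. -/
abbrev LinForm (V : Type) : Type := V → F2

/-- A linear literal: an equation `f = a` where `f` is a linear form and `a ∈ F2`. -/
abbrev LinLit (V : Type) : Type := LinForm V × F2

/-- A linear clause: a finite disjunction of linear literals. -/
abbrev LinClause (V : Type) : Type := Finset (LinLit V)

/-- A linear system: a finite conjunction of linear equations. -/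
abbrev LinSystem (V : Type) : Type := Finset (LinLit V)

/-- A linear CNF formula: a conjunction of linear clauses. -/
abbrev LinCNF (V : Type) : Type := Set (LinClause V)

variable {V : Type}

/-- Evaluation of a linear form at an assignment. -/
def evalForm [Fintype V] (f : LinForm V) (σ : V → F2) : F2 := ∑ v, f v * σ v

/-- The assignment `σ` satisfies the linear equation `l.1 = l.2`. -/
def LitSat [Fintype V] (σ : V → F2) (l : LinLit V) : Prop := evalForm l.1 σ = l.2

/-- The assignment `σ` satisfies the linear clause `C` (some literal of `C` holds). -/
def ClauseSat [Fintype V] (σ : V → F2) (C : LinClause V) : Prop := ∃ l ∈ C, LitSat σ l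

/-- The assignment `σ` is a solution of the linear system `S` (all equations hold). -/
def SysSat [Fintype V] (σ : V → F2) (S : LinSystem V) : Prop := ∀ l ∈ S, LitSat σ l

/-- The assignment `σ` satisfies the linear CNF `φ`. -/
def CNFSat [Fintype V] (σ : V → F2) (φ : LinCNF V) : Prop := ∀ C ∈ φ, ClauseSat σ C

/-- The linear CNF `φ` is unsatisfiable. -/
def Unsat [Fintype V] (φ : LinCNF V) : Prop := ¬ ∃ σ, CNFSat σ φ

/-- The positive literal `v = 1` for a single variable `v`. -/
def posLit [DecidableEq V] (v : V) : LinLit V := (Pi.single v 1, 1)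

/-- The negative literal `v = 0` for a single variable `v`. -/
def negLit [DecidableEq V] (v : V) : LinLit V := (Pi.single v 1, 0)

/-- A solution is `F`-proper if it satisfies every clause of `F`. -/
def FProper [Fintype V] (F : Set (LinClause V)) (σ : V → F2) : Prop := ∀ C ∈ F, ClauseSat σ C

/-- `φ` is `m`-extensible w.r.t. `F`: every linear system with fewer than `m` equations
that has an `F`-proper solution has, for each clause `C ∈ φ \ F`, an `F`-proper solution
satisfying `C`. -/
def Extensible [Fintype V] (φ : LinCNF V) (F : Set (LinClause V)) (m : ℕ) : Prop :=
  ∀ S : LinSystem V, S.card < m → (∃ σ, SysSat σ S ∧ FProper F σ) →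
    ∀ C ∈ φ \ F, ∃ τ, SysSat τ S ∧ FProper F τ ∧ ClauseSat τ C

/-- A binary proof tree whose nodes are labeled with linear clauses. -/
inductive ProofTree (V : Type) : Type where
  | leaf (C : LinClause V) : ProofTree V
  | weak (C : LinClause V) (t : ProofTree V) : ProofTree V
  | res (C : LinClause V) (t₁ t₂ : ProofTree V) : ProofTree V

/-- The clause at the root of a proof tree. -/
def ProofTree.concl : ProofTree V → LinClause V
  | .leaf C => C
  | .weak C _ => C
  | .res C _ _ => C

/-- The size of a proof tree: its number of nodes. -/
def ProofTree.size : ProofTree V → ℕ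
  | .leaf _ => 1
  | .weak _ t => t.size + 1
  | .res _ t₁ t₂ => t₁.size + t₂.size + 1

/-- A proof tree is valid w.r.t. `φ` if leaves are labeled by clauses of `φ` and each
internal node is obtained from its children by the semantic weakening rule or the
resolution rule of Res(⊕). -/
def ProofTree.Valid [Fintype V] [DecidableEq V] (φ : LinCNF V) : ProofTree V → Prop
  | .leaf C => C ∈ φ
  | .weak C t => t.Valid φ ∧ ∀ σ, ClauseSat σ t.concl → ClauseSat σ C
  | .res C t₁ t₂ => t₁.Valid φ ∧ t₂.Valid φ ∧
      ∃ (f : LinForm V) (A B : LinClause V),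
        t₁.concl = insert (f, (0 : F2)) A ∧ t₂.concl = insert (f, (1 : F2)) B ∧ C = A ∪ B

/-- A tree-like Res(⊕) refutation of `φ`: a valid proof tree deriving the empty clause. -/
def IsTreeRefutation [Fintype V] [DecidableEq V] (φ : LinCNF V) (T : ProofTree V) : Prop :=
  T.Valid φ ∧ T.concl = ∅

/-- A configuration: a finite set of linear clauses kept in memory. -/
abbrev Config (V : Type) : Type := Finset (LinClause V)

/-- Semantic inference: `C` follows from clauses in `S` by the resolution rule or the
semantic weakening rule. -/
def InferSem [Fintype V] [DecidableEq V] (S : Config V) (C : LinClause V) : Prop :=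
  (∃ (f : LinForm V) (A B : LinClause V),
      insert (f, (0 : F2)) A ∈ S ∧ insert (f, (1 : F2)) B ∈ S ∧ C = A ∪ B) ∨
  (∃ D ∈ S, ∀ σ, ClauseSat σ D → ClauseSat σ C)

/-- The identically zero linear form. -/
def zeroForm (V : Type) : LinForm V := fun _ => 0

/-- Syntactic inference: `C` follows from clauses in `S` by the resolution rule,
the simplification rule, the syntactic weakening rule, or the addition rule. -/
def InferSyn [Fintype V] [DecidableEq V] (S : Config V) (C : LinClause V) : Prop :=
  (∃ (f : LinForm V) (A B : LinClause V),
      insert (f, (0 : F2)) A ∈ S ∧ insert (f, (1 : F2)) B ∈ S ∧ C = A ∪ B) ∨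
  (insert ((zeroForm V, (1 : F2)) : LinLit V) C ∈ S) ∨
  (∃ (D : LinClause V) (f : LinForm V) (α : F2), D ∈ S ∧ C = insert (f, α) D) ∨
  (∃ (D : LinClause V) (f₁ f₂ : LinForm V) (α₁ α₂ : F2),
      insert (f₁, α₁) (insert (f₂, α₂) D) ∈ S ∧
      C = insert (f₁, α₁) (insert (f₁ + f₂, α₁ + α₂ + 1) D))

/-- One step of a configuration-style refutation: download a clause of `φ`,
erase a clause, or add a clause inferred (via `Inf`) from the current configuration. -/
inductive ConfigStep [Fintype V] [DecidableEq V] (φ : LinCNF V)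
    (Inf : Config V → LinClause V → Prop) : Config V → Config V → Prop
  | download {S : Config V} {C : LinClause V} (h : C ∈ φ) : ConfigStep φ Inf S (insert C S)
  | erase {S : Config V} {C : LinClause V} (h : C ∈ S) : ConfigStep φ Inf S (S.erase C)
  | infer {S : Config V} {C : LinClause V} (h : Inf S C) : ConfigStep φ Inf S (insert C S)

/-- A configuration-style Res(⊕) refutation of `φ` with inference rules `Inf`:
a sequence of configurations starting from the empty configuration, each obtained from
the previous one by a basic step, ending with a configuration containing the empty
clause. -/
def IsConfigRefutation [Fintype V] [DecidableEq V] (φ : LinCNF V)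
    (Inf : Config V → LinClause V → Prop) (π : List (Config V)) : Prop :=
  π.head? = some (∅ : Config V) ∧ List.Chain' (ConfigStep φ Inf) π ∧
    ∃ S : Config V, π.getLast? = some S ∧ (∅ : LinClause V) ∈ S

/-- The space of a sequence of configurations: the maximum number of clauses in memory. -/
def spaceOf (π : List (Config V)) : ℕ := (π.map Finset.card).foldr max 0

/-- An assignment to the variables `x_{ij}` is ORDER-proper if setting `i ≺ j ⟺ x_{ij} = 1`
defines a strict linear order on `[n]`: it satisfies all antisymmetry, totality, and
transitivity clauses. -/
def OrderProper {n : ℕ} (σ : Fin n × Fin n → F2) : Prop :=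
  (∀ i j : Fin n, i ≠ j → ¬(σ (i, j) = 1 ∧ σ (j, i) = 1)) ∧
  (∀ i j : Fin n, i ≠ j → σ (i, j) = 1 ∨ σ (j, i) = 1) ∧
  (∀ i j k : Fin n, i ≠ j → j ≠ k → i ≠ k →
    σ (i, j) = 1 → σ (j, k) = 1 → σ (i, k) = 1)

/-- The non-minimality clause `NM_i = ⋁_{j ≠ i} x_{ji}`. -/
def nonMinClause {n : ℕ} (i : Fin n) : LinClause (Fin n × Fin n) :=
  (Finset.univ.filter fun j : Fin n => j ≠ i).image fun j => posLit (j, i)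

/-- The ordering principle `Ordering_n` as a linear CNF. -/
def OrderingCNF (n : ℕ) : LinCNF (Fin n × Fin n) :=
  {C | ∃ i j : Fin n, i ≠ j ∧ C = ({negLit (i, j), negLit (j, i)} : LinClause (Fin n × Fin n))} ∪
  {C | ∃ i j : Fin n, i ≠ j ∧ C = ({posLit (i, j), posLit (j, i)} : LinClause (Fin n × Fin n))} ∪
  {C | ∃ i j k : Fin n, i ≠ j ∧ j ≠ k ∧ i ≠ k ∧
        C = ({negLit (i, j), negLit (j, k), posLit (i, k)} : LinClause (Fin n × Fin n))} ∪
  {C | ∃ i : Fin n, C = nonMinClause i}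

theorem evalForm_single {V : Type} [Fintype V] [DecidableEq V] (v : V) (σ : V → F2) :
    evalForm (Pi.single v 1) σ = σ v := by
  simp [evalForm, Pi.single_apply]

theorem litSat_posLit {V : Type} [Fintype V] [DecidableEq V] (v : V) (σ : V → F2) :
    LitSat σ (posLit v) ↔ σ v = 1 := by
  simp [LitSat, posLit, evalForm_single]

theorem litSat_negLit {V : Type} [Fintype V] [DecidableEq V] (v : V) (σ : V → F2) :
    LitSat σ (negLit v) ↔ σ v = 0 := by
  simp [LitSat, negLit, evalForm_single]

theorem evalForm_add {V : Type} [Fintype V] (f : LinForm V) (σ τ : V → F2) :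
    evalForm f (σ + τ) = evalForm f σ + evalForm f τ := by
  simp [evalForm, mul_add, Finset.sum_add_distrib]

theorem F2.eq_zero_or_eq_one (a : F2) : a = 0 ∨ a = 1 := by
  revert a; decide

theorem clauseSat_nonMinClause {n : ℕ} (i : Fin n) (σ : Fin n × Fin n → F2) :
    ClauseSat σ (nonMinClause i) ↔ ∃ j, j ≠ i ∧ σ (j, i) = 1 := by
  simp [ClauseSat, nonMinClause, litSat_posLit]

/-- A clause of the ordering principle is a non-minimality clause or holds in every
linear order. -/
theorem orderingCNF_cases {n : ℕ} {C : LinClause (Fin n × Fin n)} (hC : C ∈ OrderingCNF n) :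
    (∃ i, C = nonMinClause i) ∨ ∀ σ, OrderProper σ → ClauseSat σ C := by
  rcases hC with ((⟨i, j, hij, rfl⟩ | ⟨i, j, hij, rfl⟩) | ⟨i, j, k, hij, hjk, hik, rfl⟩) | h
  · right
    intro σ hσ
    have h := hσ.1 i j hij
    have hi := F2.eq_zero_or_eq_one (σ (i, j))
    have hj := F2.eq_zero_or_eq_one (σ (j, i))
    simp only [ClauseSat, Finset.mem_insert, Finset.mem_singleton, exists_eq_or_imp,
      exists_eq_left, litSat_negLit]
    tauto
  · right
    intro σ hσ
    simpa [ClauseSat, litSat_posLit] using hσ.2.1 i j hij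
  · right
    intro σ hσ
    have h := hσ.2.2 i j k hij hjk hik
    have hi := F2.eq_zero_or_eq_one (σ (i, j))
    have hj := F2.eq_zero_or_eq_one (σ (j, k))
    simp only [ClauseSat, Finset.mem_insert, Finset.mem_singleton, exists_eq_or_imp,
      exists_eq_left, litSat_negLit, litSat_posLit]
    tauto
  · exact Or.inl h

/-- The change of the order `σ` obtained by moving the elements of the indicator `x` to the
front, in reversed order. It is linear in `x`. -/
def frontShift {n : ℕ} (σ : Fin n × Fin n → F2) :
    (Fin n → F2) →ₗ[F2] (Fin n × Fin n → F2) where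
  toFun x v := if v.1 = v.2 then 0 else if σ v = 1 then x v.2 else x v.1
  map_add' x y := by
    ext v
    simp only [Pi.add_apply]
    split_ifs <;> simp
  map_smul' c x := by
    ext v
    simp only [Pi.smul_apply, RingHom.id_apply]
    split_ifs <;> simp

theorem add_frontShift_apply {n : ℕ} (σ : Fin n × Fin n → F2) (x : Fin n → F2) {p q : Fin n}
    (h : p ≠ q) :
    (σ + frontShift σ x) (p, q) = σ (p, q) + if σ (p, q) = 1 then x q else x p := by
  simp [frontShift, h]

theorem OrderProper.swap {n : ℕ} {σ : Fin n × Fin n → F2} (hσ : OrderProper σ) {p q : Fin n}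
    (h : p ≠ q) : σ (q, p) = 1 + σ (p, q) := by
  have h₁ := hσ.1 p q h
  have h₂ := hσ.2.1 p q h
  generalize σ (p, q) = a at *
  generalize σ (q, p) = b at *
  revert a b; decide

theorem OrderProper.add_frontShift {n : ℕ} {σ : Fin n × Fin n → F2} (hσ : OrderProper σ)
    (x : Fin n → F2) : OrderProper (σ + frontShift σ x) := by
  refine ⟨fun i j hij => ?_, fun i j hij => ?_, fun i j k hij hjk hik => ?_⟩
  · rw [add_frontShift_apply σ x hij, add_frontShift_apply σ x hij.symm, hσ.swap hij]
    generalize σ (i, j) = a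
    generalize x i = u
    generalize x j = v
    revert a u v; decide
  · rw [add_frontShift_apply σ x hij, add_frontShift_apply σ x hij.symm, hσ.swap hij]
    generalize σ (i, j) = a
    generalize x i = u
    generalize x j = v
    revert a u v; decide
  · rw [add_frontShift_apply σ x hij, add_frontShift_apply σ x hjk, add_frontShift_apply σ x hik]
    have h₁ := hσ.2.2 i j k hij hjk hik
    have h₂ := hσ.2.2 k j i hjk.symm hij.symm hik.symm
    rw [hσ.swap hij, hσ.swap hjk, hσ.swap hik] at h₂
    generalize σ (i, j) = a at *
    generalize σ (j, k) = b at *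
    generalize σ (i, k) = c at *
    generalize x i = u
    generalize x j = v
    generalize x k = w
    revert a b c u v w; decide

/-- Fewer than `n - 1` linear equations satisfied by some linear order are satisfied by a
linear order in which a prescribed element is not minimal. -/
theorem OrderProper.exists_nonMin {n : ℕ} {σ : Fin n × Fin n → F2} (hσ : OrderProper σ)
    {S : LinSystem (Fin n × Fin n)} (hS : SysSat σ S) (hcard : S.card < n - 1) (i : Fin n) :
    ∃ τ, OrderProper τ ∧ SysSat τ S ∧ ClauseSat τ (nonMinClause i) := by
  by_cases hi : ∃ j, j ≠ i ∧ σ (j, i) = 1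
  · exact ⟨σ, hσ, hS, (clauseSat_nonMinClause i σ).2 hi⟩
  push Not at hi
  let L : (Fin n → F2) →ₗ[F2] (S → F2) × F2 :=
    { toFun := fun x => (fun l => evalForm l.1.1 (frontShift σ x), x i)
      map_add' := fun x y => by
        ext <;> simp [evalForm_add]
      map_smul' := fun c x => by
        ext <;> simp [evalForm, Finset.mul_sum, mul_left_comm] }
  have hker : LinearMap.ker L ≠ ⊥ := by
    apply LinearMap.ker_ne_bot_of_finrank_lt
    simp
    omega
  obtain ⟨x, hx, hx0⟩ := Submodule.exists_mem_ne_zero_of_ne_bot hker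
  have hL : L x = 0 := hx
  have hxS : ∀ l ∈ S, evalForm l.1 (frontShift σ x) = 0 := fun l hl =>
    congrFun (congrArg Prod.fst hL) ⟨l, hl⟩
  have hxi : x i = 0 := congrArg Prod.snd hL
  obtain ⟨j, hj⟩ := Function.ne_iff.1 hx0
  have hji : j ≠ i := by
    rintro rfl
    exact hj hxi
  refine ⟨σ + frontShift σ x, hσ.add_frontShift x, fun l hl => ?_,
    (clauseSat_nonMinClause i _).2 ⟨j, hji, ?_⟩⟩
  · have h : evalForm l.1 σ = l.2 := hS l hl
    simp [LitSat, evalForm_add, hxS l hl, h]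
  · have h₀ := (F2.eq_zero_or_eq_one (σ (j, i))).resolve_right (hi j hji)
    have h₁ := (F2.eq_zero_or_eq_one (x j)).resolve_left hj
    rw [add_frontShift_apply σ x hji, h₀, h₁, if_neg zero_ne_one, zero_add]

theorem clauseSat_union_of_resolution {V : Type} [Fintype V] [DecidableEq V] {σ : V → F2}
    {f : LinForm V} {A B : LinClause V} (hA : ClauseSat σ (insert (f, (0 : F2)) A))
    (hB : ClauseSat σ (insert (f, (1 : F2)) B)) : ClauseSat σ (A ∪ B) := by
  obtain ⟨l, hl, hls⟩ := hA
  obtain ⟨m, hm, hms⟩ := hB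
  rcases Finset.mem_insert.1 hl with rfl | hl
  · rcases Finset.mem_insert.1 hm with rfl | hm
    · exact absurd (hls.symm.trans hms) zero_ne_one
    · exact ⟨m, Finset.mem_union_right _ hm, hms⟩
  · exact ⟨l, Finset.mem_union_left _ hl, hls⟩

/-- If a system has a linear order as a solution, and all its linear orders falsify the
conclusion of a derivation, then the derivation is large. -/
theorem ProofTree.Valid.two_pow_le_size {n : ℕ} {T : ProofTree (Fin n × Fin n)}
    (hT : T.Valid (OrderingCNF n)) (S : LinSystem (Fin n × Fin n))
    (hS : ∃ σ, OrderProper σ ∧ SysSat σ S)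
    (hC : ∀ σ, OrderProper σ → SysSat σ S → ¬ ClauseSat σ T.concl) :
    2 ^ (n - 1 - S.card) ≤ T.size := by
  induction T generalizing S with
  | leaf C =>
    obtain ⟨σ, hσ, hσS⟩ := hS
    rcases orderingCNF_cases hT with ⟨i, rfl⟩ | h
    · by_cases hcard : S.card < n - 1
      · obtain ⟨τ, hτ, hτS, hτC⟩ := hσ.exists_nonMin hσS hcard i
        exact absurd hτC (hC τ hτ hτS)
      · simp [Nat.sub_eq_zero_of_le (not_lt.1 hcard), ProofTree.size]
    · exact absurd (h σ hσ) (hC σ hσ hσS)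
  | weak C t ih =>
    have := ih hT.1 S hS fun σ hσ hσS h => hC σ hσ hσS (hT.2 σ h)
    simp only [ProofTree.size]
    omega
  | res C t₁ t₂ ih₁ ih₂ =>
    obtain ⟨h₁, h₂, f, A, B, hA, hB, rfl⟩ := hT
    have hnot : ∀ σ, OrderProper σ → SysSat σ S → ∀ l ∈ A ∪ B, ¬ LitSat σ l :=
      fun σ hσ hσS l hl hls => hC σ hσ hσS ⟨l, hl, hls⟩
    have sat_insert : ∀ (a : F2) (σ : Fin n × Fin n → F2),
        SysSat σ (insert (f, a) S) ↔ LitSat σ (f, a) ∧ SysSat σ S := fun a σ => by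
      simp [SysSat]
    have concl₁ : ∀ σ, OrderProper σ → SysSat σ S → evalForm f σ ≠ 0 →
        ¬ ClauseSat σ t₁.concl := by
      rintro σ hσ hσS hf ⟨l, hl, hls⟩
      rw [hA] at hl
      rcases Finset.mem_insert.1 hl with rfl | hl
      · exact hf hls
      · exact hnot σ hσ hσS l (Finset.mem_union_left _ hl) hls
    have concl₂ : ∀ σ, OrderProper σ → SysSat σ S → evalForm f σ ≠ 1 →
        ¬ ClauseSat σ t₂.concl := by
      rintro σ hσ hσS hf ⟨l, hl, hls⟩
      rw [hB] at hl
      rcases Finset.mem_insert.1 hl with rfl | hl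
      · exact hf hls
      · exact hnot σ hσ hσS l (Finset.mem_union_right _ hl) hls
    simp only [ProofTree.size]
    by_cases hf₁ : ∃ σ, OrderProper σ ∧ SysSat σ (insert (f, (1 : F2)) S)
    · by_cases hf₀ : ∃ σ, OrderProper σ ∧ SysSat σ (insert (f, (0 : F2)) S)
      · have b₁ := ih₁ h₁ _ hf₁ fun σ hσ hσS => by
          obtain ⟨hl, hσS⟩ := (sat_insert _ _).1 hσS
          exact concl₁ σ hσ hσS fun h => zero_ne_one (h.symm.trans hl)
        have b₂ := ih₂ h₂ _ hf₀ fun σ hσ hσS => by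
          obtain ⟨hl, hσS⟩ := (sat_insert _ _).1 hσS
          exact concl₂ σ hσ hσS fun h => one_ne_zero (h.symm.trans hl)
        have e₁ : 2 ^ (n - 1 - S.card - 1) ≤ t₁.size :=
          (Nat.pow_le_pow_right two_pos (by
            have := Finset.card_insert_le (f, (1 : F2)) S; omega)).trans b₁
        have e₂ : 2 ^ (n - 1 - S.card - 1) ≤ t₂.size :=
          (Nat.pow_le_pow_right two_pos (by
            have := Finset.card_insert_le (f, (0 : F2)) S; omega)).trans b₂
        cases hk : n - 1 - S.card with
        | zero => simp
        | succ k =>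
          rw [hk, Nat.add_sub_cancel] at e₁ e₂
          rw [pow_succ]
          omega
      · have := ih₁ h₁ S hS fun σ hσ hσS => concl₁ σ hσ hσS fun h =>
          hf₀ ⟨σ, hσ, (sat_insert _ _).2 ⟨h, hσS⟩⟩
        omega
    · have := ih₂ h₂ S hS fun σ hσ hσS => concl₂ σ hσ hσS fun h =>
        hf₁ ⟨σ, hσ, (sat_insert _ _).2 ⟨h, hσS⟩⟩
      omega

/-- Choosing one true literal from each clause. -/
theorem exists_literals_of_clauseSat {V : Type} [Fintype V] {σ : V → F2} {S : Config V}
    (h : ∀ C ∈ S, ClauseSat σ C) :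
    ∃ L : LinSystem V, L.card ≤ S.card ∧ SysSat σ L ∧
      ∀ τ, SysSat τ L → ∀ C ∈ S, ClauseSat τ C := by
  classical
  choose g hg hgs using h
  refine ⟨S.attach.image fun C => g C.1 C.2, ?_, ?_, fun τ hτ C hC => ?_⟩
  · exact Finset.card_image_le.trans (by simp)
  · intro l hl
    obtain ⟨C, -, rfl⟩ := Finset.mem_image.1 hl
    exact hgs _ _
  · exact ⟨g C hC, hg C hC, hτ _ (Finset.mem_image.2 ⟨⟨C, hC⟩, Finset.mem_attach _ _, rfl⟩)⟩

theorem InferSem.clauseSat {V : Type} [Fintype V] [DecidableEq V] {S : Config V}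
    {C : LinClause V} (h : InferSem S C) {σ : V → F2} (hσ : ∀ D ∈ S, ClauseSat σ D) :
    ClauseSat σ C := by
  rcases h with ⟨f, A, B, hA, hB, rfl⟩ | ⟨D, hD, h⟩
  · exact clauseSat_union_of_resolution (hσ _ hA) (hσ _ hB)
  · exact h σ (hσ D hD)

/-- A step from a small configuration preserves satisfiability by a linear order. -/
theorem ConfigStep.exists_orderProper {n : ℕ} {S S' : Config (Fin n × Fin n)}
    (h : ConfigStep (OrderingCNF n) InferSem S S') (hcard : S.card < n - 1)
    (hS : ∃ σ, OrderProper σ ∧ ∀ C ∈ S, ClauseSat σ C) :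
    ∃ σ, OrderProper σ ∧ ∀ C ∈ S', ClauseSat σ C := by
  obtain ⟨σ, hσ, hσS⟩ := hS
  cases h with
  | download hC =>
    rcases orderingCNF_cases hC with ⟨i, rfl⟩ | h
    · obtain ⟨L, hL, hσL, hLS⟩ := exists_literals_of_clauseSat hσS
      obtain ⟨τ, hτ, hτL, hτi⟩ := hσ.exists_nonMin hσL (hL.trans_lt hcard) i
      exact ⟨τ, hτ, Finset.forall_mem_insert _ _ _ |>.2 ⟨hτi, hLS τ hτL⟩⟩
    · exact ⟨σ, hσ, Finset.forall_mem_insert _ _ _ |>.2 ⟨h σ hσ, hσS⟩⟩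
  | erase hC => exact ⟨σ, hσ, fun D hD => hσS D (Finset.mem_of_mem_erase hD)⟩
  | infer hC => exact ⟨σ, hσ, Finset.forall_mem_insert _ _ _ |>.2 ⟨hC.clauseSat hσS, hσS⟩⟩

theorem card_le_spaceOf {V : Type} {π : List (Config V)} {S : Config V} (h : S ∈ π) :
    S.card ≤ spaceOf π := by
  induction π with
  | nil => simp at h
  | cons T π ih =>
    simp only [spaceOf, List.map_cons, List.foldr_cons] at ih ⊢
    rcases List.mem_cons.1 h with rfl | h
    · exact le_max_left _ _
    · exact (ih h).trans (le_max_right _ _)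

theorem exists_orderProper_of_spaceOf_lt {n : ℕ} {π : List (Config (Fin n × Fin n))}
    (hπ : List.IsChain (ConfigStep (OrderingCNF n) InferSem) π)
    (hcard : ∀ S ∈ π, S.card < n - 1)
    (hhead : ∀ S ∈ π.head?, ∃ σ, OrderProper σ ∧ ∀ C ∈ S, ClauseSat σ C) :
    ∀ S ∈ π, ∃ σ, OrderProper σ ∧ ∀ C ∈ S, ClauseSat σ C := by
  induction π with
  | nil => simp
  | cons T π ih =>
    have hT := hhead T rfl
    rw [List.isChain_cons] at hπ
    refine List.forall_mem_cons.2 ⟨hT, ih hπ.2 (fun S hS => hcard S (by simp [hS])) ?_⟩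
    exact fun S hS => (hπ.1 S hS).exists_orderProper (hcard T (by simp)) hT

theorem exists_orderProper (n : ℕ) : ∃ σ : Fin n × Fin n → F2, OrderProper σ := by
  refine ⟨fun v => if v.1 < v.2 then 1 else 0, ?_, ?_, ?_⟩
  · intro i j _
    simpa using fun h : i < j => h.le
  · intro i j hij
    simpa using lt_or_gt_of_ne hij
  · intro i j k _ _ _
    simpa using fun (h : i < j) (h' : j < k) => h.trans h'

/-- For `n ≥ 2`: every tree-like Res(⊕) refutation of `Ordering_n` has
size at least `2^(n-2)`, and every configuration-style Res(⊕) refutation of `Ordering_n`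
has space at least `n - 2`. -/
theorem ordering_size_and_space_lower_bounds (n : ℕ) (hn : 2 ≤ n) :
    (∀ T : ProofTree (Fin n × Fin n),
        IsTreeRefutation (OrderingCNF n) T → 2 ^ (n - 2) ≤ T.size) ∧
    (∀ π : List (Config (Fin n × Fin n)),
        IsConfigRefutation (OrderingCNF n) InferSem π → n - 2 ≤ spaceOf π) := by
  obtain ⟨σ, hσ⟩ := exists_orderProper n
  refine ⟨fun T hT => ?_, fun π hπ => ?_⟩
  · have h := hT.1.two_pow_le_size ∅ ⟨σ, hσ, by simp [SysSat]⟩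
      (by simp [hT.2, ClauseSat])
    exact (Nat.pow_le_pow_right two_pos (by simp; omega)).trans h
  · by_contra! hlt
    obtain ⟨hhead, hchain, S, hlast, hS⟩ := hπ
    obtain ⟨τ, -, hτ⟩ := exists_orderProper_of_spaceOf_lt hchain
      (fun S hS => by have := card_le_spaceOf hS; omega)
      (by
        rw [hhead]
        rintro S ⟨⟩
        exact ⟨σ, hσ, by simp⟩)
      S (List.mem_of_getLast? hlast)
    simpa [ClauseSat] using hτ ∅ hS
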